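/- arXiv:2007.13304 — 2 statements merged into one kernel-verified Lean document; each statement's English description precedes it below -/
import Mathlib

section
/- Let X be a Banach space, B : X × X → X a bilinear map, and C > 0 a constant such that ‖B(v,w)‖ ≤ C‖v‖‖w‖ for all v, w ∈ X. Let 0 < ε < 1/(4C) and let v¹, w¹ ∈ X satisfy ‖v¹‖ + ‖w¹‖ ≤ ε. Then there exists a unique pair (v, w) ∈ X × X such that ‖v‖ + ‖w‖ ≤ 2ε, v = v¹ − B(w, v), and w = w¹ − B(v, w). -/
/-- **Abstract fixed point lemma (existence and uniqueness).**
Let `X` be a Banach space, `B : X × X → X` a bilinear map and `C > 0` a constant with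
`‖B v w‖ ≤ C ‖v‖ ‖w‖` for all `v w`. If `0 < ε < 1/(4C)` and `‖v¹‖ + ‖w¹‖ ≤ ε`, then
there is a unique pair `(v, w)` with `‖v‖ + ‖w‖ ≤ 2ε`, `v = v¹ - B w v` and
`w = w¹ - B v w`. -/
theorem stmt0 {X : Type*} [NormedAddCommGroup X] [NormedSpace ℝ X] [CompleteSpace X]
    (B : X →ₗ[ℝ] X →ₗ[ℝ] X) (C : ℝ) (hC : 0 < C)
    (hB : ∀ v w : X, ‖B v w‖ ≤ C * ‖v‖ * ‖w‖)
    (ε : ℝ) (hε0 : 0 < ε) (hε : ε < 1 / (4 * C))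
    (v1 w1 : X) (h1 : ‖v1‖ + ‖w1‖ ≤ ε) :
    ∃! p : X × X,
      ‖p.1‖ + ‖p.2‖ ≤ 2 * ε ∧ p.1 = v1 - B p.2 p.1 ∧ p.2 = w1 - B p.1 p.2 := by
  have hCε : 4 * C * ε < 1 := by
    rw [lt_div_iff₀ (by positivity)] at hε
    linarith
  have hK0 : 0 ≤ 4 * C * ε := by positivity
  -- one component of the difference estimate
  have key : ∀ a b a' b' : X, ∀ d : ℝ, ‖a‖ ≤ 2 * ε → ‖b‖ ≤ 2 * ε → ‖a'‖ ≤ 2 * ε →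
      ‖b'‖ ≤ 2 * ε → ‖a - a'‖ ≤ d → ‖b - b'‖ ≤ d → ‖B a b - B a' b'‖ ≤ 4 * C * ε * d := by
    intro a b a' b' d ha hb ha' hb' hda hdb
    have e : B a b - B a' b' = B (a - a') b + B a' (b - b') := by
      simp only [map_sub, LinearMap.sub_apply]
      abel
    have hd : 0 ≤ d := (norm_nonneg _).trans hda
    have t1 : ‖B (a - a') b‖ ≤ C * d * (2 * ε) :=
      (hB _ _).trans (by gcongr)
    have t2 : ‖B a' (b - b')‖ ≤ C * (2 * ε) * d :=
      (hB _ _).trans (by gcongr)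
    rw [e]
    refine (norm_add_le _ _).trans ?_
    linarith
  let T : X × X → X × X := fun p => (v1 - B p.2 p.1, w1 - B p.1 p.2)
  let s : Set (X × X) := {p | ‖p.1‖ + ‖p.2‖ ≤ 2 * ε}
  have hT : ∀ p ∈ s, ∀ q ∈ s, dist (T p) (T q) ≤ 4 * C * ε * dist p q := by
    intro p hp q hq
    have hp' : ‖p.1‖ + ‖p.2‖ ≤ 2 * ε := hp
    have hq' : ‖q.1‖ + ‖q.2‖ ≤ 2 * ε := hq
    have n1 := norm_nonneg p.1
    have n2 := norm_nonneg p.2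
    have n3 := norm_nonneg q.1
    have n4 := norm_nonneg q.2
    have d1 : ‖q.1 - p.1‖ ≤ dist p q := by
      rw [norm_sub_rev, ← dist_eq_norm]; exact le_max_left _ _
    have d2 : ‖q.2 - p.2‖ ≤ dist p q := by
      rw [norm_sub_rev, ← dist_eq_norm]; exact le_max_right _ _
    refine max_le ?_ ?_
    · rw [dist_eq_norm]
      have e : (T p).1 - (T q).1 = B q.2 q.1 - B p.2 p.1 := by
        simp only [T]; abel
      rw [e]
      exact key _ _ _ _ _ (by linarith) (by linarith) (by linarith) (by linarith) d2 d1
    · rw [dist_eq_norm]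
      have e : (T p).2 - (T q).2 = B q.1 q.2 - B p.1 p.2 := by
        simp only [T]; abel
      rw [e]
      exact key _ _ _ _ _ (by linarith) (by linarith) (by linarith) (by linarith) d1 d2
  have hmaps : Set.MapsTo T s s := by
    intro p hp
    have hp' : ‖p.1‖ + ‖p.2‖ ≤ 2 * ε := hp
    have n1 := norm_nonneg p.1
    have n2 := norm_nonneg p.2
    change ‖v1 - B p.2 p.1‖ + ‖w1 - B p.1 p.2‖ ≤ 2 * ε
    have a1 := norm_sub_le v1 (B p.2 p.1)
    have a2 := norm_sub_le w1 (B p.1 p.2)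
    have b1 := hB p.2 p.1
    have b2 := hB p.1 p.2
    have c1 : ‖p.1‖ * ‖p.2‖ ≤ ε * ε := by
      nlinarith [sq_nonneg (‖p.1‖ - ‖p.2‖)]
    have c2 : C * (‖p.1‖ * ‖p.2‖) ≤ C * (ε * ε) := by gcongr
    have c3 : 4 * C * ε * ε ≤ 1 * ε := by gcongr
    nlinarith
  have hclosed : IsClosed s :=
    isClosed_le (by fun_prop) continuous_const
  have hcontr : ContractingWith ⟨4 * C * ε, hK0⟩ (hmaps.restrict T s s) := by
    refine ⟨by exact_mod_cast hCε, LipschitzWith.of_dist_le_mul ?_⟩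
    intro p q
    exact hT p p.2 q q.2
  have h0 : (0 : X × X) ∈ s := by
    change ‖(0 : X)‖ + ‖(0 : X)‖ ≤ 2 * ε
    simp only [norm_zero]; linarith
  obtain ⟨p, hps, hfix, -⟩ :=
    hcontr.exists_fixedPoint' hclosed.isComplete hmaps h0 (edist_ne_top _ _)
  refine ⟨p, ⟨hps, ?_, ?_⟩, ?_⟩
  · exact (congrArg Prod.fst hfix).symm
  · exact (congrArg Prod.snd hfix).symm
  · rintro q ⟨hqs, hq1, hq2⟩
    have hq : T q = q := Prod.ext hq1.symm hq2.symm
    have h := hT q hqs p hps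
    rw [hq, hfix.eq] at h
    have hd : 0 ≤ dist q p := dist_nonneg
    exact dist_le_zero.mp (by nlinarith)
end

section
/- There exists a constant C > 0 such that the following holds for every T ∈ (0, ∞] and every measurable function F : (0, T) × ℝ³ → ℂ with ∫_0^T ∫_{ℝ³} |2πξ|^{−1} |F(s, ξ)|² dξ ds < ∞. Define u(t, ξ) = ∫_0^t e^{−4π² |ξ|² (t − s)} F(s, ξ) ds (the integral converges absolutely for a.e. ξ ≠ 0 and every t ∈ (0, T)). Then sup_{0 < t < T} ∫_{ℝ³} |2πξ| |u(t, ξ)|² dξ + ∫_0^T ∫_{ℝ³} |2πξ|³ |u(t, ξ)|² dξ dt ≤ C ∫_0^T ∫_{ℝ³} |2πξ|^{−1} |F(s, ξ)|² dξ ds. -/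
open MeasureTheory Real Set
open scoped ENNReal

noncomputable def heatK (r x : ℝ) : ℝ≥0∞ :=
  if 0 < x then ENNReal.ofReal (Real.exp (-(r ^ 2 * x))) else 0

lemma heatK_meas : Measurable (fun p : ℝ × ℝ => heatK p.1 p.2) := by
  unfold heatK
  refine Measurable.ite ?_ ?_ measurable_const
  · exact measurableSet_lt measurable_const measurable_snd
  · fun_prop

lemma heatK_le_one (r x : ℝ) : heatK r x ≤ 1 := by
  unfold heatK
  split_ifs with h
  · rw [ENNReal.ofReal_le_one, Real.exp_le_one_iff]
    have : 0 ≤ r ^ 2 * x := by positivity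
    linarith
  · simp

lemma heatK_int {r : ℝ} (hr : 0 < r) : ∫⁻ x, heatK r x = ENNReal.ofReal ((r ^ 2)⁻¹) := by
  have h1 : (fun x => heatK r x)
      = (Ioi (0:ℝ)).indicator (fun x => ENNReal.ofReal (Real.exp (-(r ^ 2) * x))) := by
    ext x
    simp [heatK, Set.indicator]
  have h2 : -(r ^ 2) < 0 := by have : 0 < r ^ 2 := by positivity
                               linarith
  rw [h1, lintegral_indicator measurableSet_Ioi, ← ofReal_integral_eq_lintegral_ofReal]
  · rw [integral_exp_mul_Ioi h2]
    congr 1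
    simp
  · exact integrableOn_exp_mul_Ioi h2 0
  · exact Filter.Eventually.of_forall fun x => (Real.exp_pos _).le

lemma cs_weight {α : Type*} [MeasurableSpace α] (μ : Measure α) {k f : α → ℝ≥0∞}
    (hk : Measurable k) (hf : Measurable f) :
    (∫⁻ x, k x * f x ∂μ) ^ 2 ≤ (∫⁻ x, k x ∂μ) * ∫⁻ x, k x * f x ^ 2 ∂μ := by
  have hs : ∀ y : ℝ≥0∞, (y ^ (1/2 : ℝ)) * (y ^ (1/2 : ℝ)) = y := by
    intro y
    rw [← ENNReal.rpow_add_of_nonneg _ _ (by norm_num) (by norm_num)]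
    norm_num
  have h := ENNReal.lintegral_mul_le_Lp_mul_Lq μ Real.HolderConjugate.two_two
    (f := fun x => k x ^ (1/2 : ℝ)) (g := fun x => k x ^ (1/2 : ℝ) * f x)
    (by fun_prop) (by fun_prop)
  have e1 : ∀ x, ((fun x => k x ^ (1/2 : ℝ)) * (fun x => k x ^ (1/2 : ℝ) * f x)) x = k x * f x := by
    intro x
    simp only [Pi.mul_apply]
    rw [← mul_assoc, hs]
  have e2 : ∀ x, (k x ^ (1/2 : ℝ)) ^ (2:ℝ) = k x := by
    intro x
    rw [← ENNReal.rpow_mul]; norm_num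
  have e3 : ∀ x, (k x ^ (1/2 : ℝ) * f x) ^ (2:ℝ) = k x * f x ^ 2 := by
    intro x
    rw [ENNReal.mul_rpow_of_nonneg _ _ (by norm_num), e2]
    norm_num
  simp only [e1, e2, e3] at h
  calc _ ≤ _ := pow_le_pow_left' h 2
    _ = _ := by
      rw [mul_pow, sq, sq, hs, hs]

lemma u_bound {S : Set ℝ} {f : ℝ → ℂ} (hf : Measurable f) {r t : ℝ} (hr : 0 < r)
    (hS : Ioo 0 t ⊆ S) :
    (‖∫ s in Ioo (0:ℝ) t, (Real.exp (-(r ^ 2 * (t - s))) : ℂ) * f s‖₊ : ℝ≥0∞) ^ 2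
      ≤ ENNReal.ofReal ((r ^ 2)⁻¹) * ∫⁻ s in S, heatK r (t - s) * (‖f s‖₊ : ℝ≥0∞) ^ 2 := by
  have hk : Measurable (fun s => heatK r (t - s)) :=
    heatK_meas.comp (measurable_const.prodMk (measurable_const.sub measurable_id))
  have h1 : (‖∫ s in Ioo (0:ℝ) t, (Real.exp (-(r ^ 2 * (t - s))) : ℂ) * f s‖₊ : ℝ≥0∞)
      ≤ ∫⁻ s in Ioo (0:ℝ) t, heatK r (t - s) * (‖f s‖₊ : ℝ≥0∞) := by
    refine (enorm_integral_le_lintegral_enorm _).trans ?_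
    refine setLIntegral_mono' measurableSet_Ioo fun s hs => ?_
    rw [enorm_mul, heatK, if_pos (by linarith [hs.2])]
    refine mul_le_mul' (le_of_eq ?_) le_rfl
    rw [← ofReal_norm, Complex.norm_real, Real.norm_of_nonneg (Real.exp_pos _).le]
  refine (pow_le_pow_left' h1 2).trans ((cs_weight _ hk (by fun_prop)).trans ?_)
  refine mul_le_mul' ?_ (lintegral_mono_set hS)
  refine (setLIntegral_le_lintegral _ _).trans ?_
  rw [lintegral_sub_left_eq_self (fun x => heatK r x) t, heatK_int hr]

lemma swap3 {E : Type*} [MeasurableSpace E] (μ : Measure ℝ) (ν : Measure E) [SFinite μ] [SFinite ν]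
    (G : ℝ → ℝ → E → ℝ≥0∞) (hG : Measurable (fun p : (ℝ × ℝ) × E => G p.1.1 p.1.2 p.2)) :
    ∫⁻ t, ∫⁻ ξ, ∫⁻ s, G t s ξ ∂μ ∂ν ∂μ = ∫⁻ s, ∫⁻ ξ, ∫⁻ t, G t s ξ ∂μ ∂ν ∂μ := by
  have h1 : ∀ t, Measurable (fun p : E × ℝ => G t p.2 p.1) := fun t =>
    hG.comp (g := fun p : (ℝ × ℝ) × E => G p.1.1 p.1.2 p.2)
      (f := fun p : E × ℝ => ((t, p.2), p.1)) (by fun_prop)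
  have h2 : ∀ s, Measurable (fun p : ℝ × E => G p.1 s p.2) := fun s =>
    hG.comp (g := fun p : (ℝ × ℝ) × E => G p.1.1 p.1.2 p.2)
      (f := fun p : ℝ × E => ((p.1, s), p.2)) (by fun_prop)
  have h3 : Measurable (fun p : ℝ × ℝ => ∫⁻ ξ, G p.1 p.2 ξ ∂ν) := hG.lintegral_prod_right'
  calc _ = ∫⁻ t, ∫⁻ s, ∫⁻ ξ, G t s ξ ∂ν ∂μ ∂μ :=
        lintegral_congr fun t => lintegral_lintegral_swap (h1 t).aemeasurable
    _ = ∫⁻ s, ∫⁻ t, ∫⁻ ξ, G t s ξ ∂ν ∂μ ∂μ := lintegral_lintegral_swap h3.aemeasurable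
    _ = _ := lintegral_congr fun s => lintegral_lintegral_swap (h2 s).aemeasurable

set_option maxHeartbeats 400000 in
/-- **Energy and maximal-regularity estimate for the Duhamel integral of the heat semigroup,
on the Fourier side:** there is `C > 0` such that for every `T ∈ (0, ∞]` and every measurable
`F` on `(0,T) × ℝ³` with `∫_0^T ∫ |2πξ|⁻¹ |F(s,ξ)|² dξ ds < ∞`, the function
`u(t,ξ) = ∫_0^t e^{−4π²|ξ|²(t−s)} F(s,ξ) ds` satisfies
`sup_{0<t<T} ∫ |2πξ| |u(t,ξ)|² dξ + ∫_0^T ∫ |2πξ|³ |u(t,ξ)|² dξ dt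
  ≤ C ∫_0^T ∫ |2πξ|⁻¹ |F(s,ξ)|² dξ ds`. -/
theorem stmt15 :
    ∃ C : ℝ, 0 < C ∧
      ∀ (T : ℝ≥0∞), 0 < T →
      ∀ (F : ℝ → EuclideanSpace ℝ (Fin 3) → ℂ),
        Measurable (Function.uncurry F) →
        (∫⁻ s in {s : ℝ | 0 < s ∧ ENNReal.ofReal s < T},
            ∫⁻ ξ : EuclideanSpace ℝ (Fin 3),
              ENNReal.ofReal ((2 * Real.pi * ‖ξ‖) ^ (-1 : ℝ)) * (‖F s ξ‖₊ : ℝ≥0∞) ^ (2:ℕ)) < ⊤ →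
        ∀ u : ℝ → EuclideanSpace ℝ (Fin 3) → ℂ,
          (∀ (t : ℝ) (ξ : EuclideanSpace ℝ (Fin 3)),
            u t ξ = ∫ s in Ioo (0:ℝ) t,
              (Real.exp (-(4 * Real.pi ^ 2 * ‖ξ‖ ^ 2 * (t - s))) : ℂ) * F s ξ) →
          (⨆ t ∈ {t : ℝ | 0 < t ∧ ENNReal.ofReal t < T},
              ∫⁻ ξ : EuclideanSpace ℝ (Fin 3),
                ENNReal.ofReal (2 * Real.pi * ‖ξ‖) * (‖u t ξ‖₊ : ℝ≥0∞) ^ (2:ℕ)) +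
            (∫⁻ t in {t : ℝ | 0 < t ∧ ENNReal.ofReal t < T},
              ∫⁻ ξ : EuclideanSpace ℝ (Fin 3),
                ENNReal.ofReal ((2 * Real.pi * ‖ξ‖) ^ (3:ℕ)) * (‖u t ξ‖₊ : ℝ≥0∞) ^ (2:ℕ)) ≤
          ENNReal.ofReal C *
            ∫⁻ s in {s : ℝ | 0 < s ∧ ENNReal.ofReal s < T},
              ∫⁻ ξ : EuclideanSpace ℝ (Fin 3),
                ENNReal.ofReal ((2 * Real.pi * ‖ξ‖) ^ (-1 : ℝ)) * (‖F s ξ‖₊ : ℝ≥0∞) ^ (2:ℕ) := by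
  refine ⟨2, by norm_num, ?_⟩
  intro T hT F hF _ u hu
  set S : Set ℝ := {s : ℝ | 0 < s ∧ ENNReal.ofReal s < T} with hSdef
  have hS : ∀ t ∈ S, Ioo 0 t ⊆ S := fun t ht s hs =>
    ⟨hs.1, (ENNReal.ofReal_le_ofReal hs.2.le).trans_lt ht.2⟩
  set R : EuclideanSpace ℝ (Fin 3) → ℝ := fun ξ => 2 * Real.pi * ‖ξ‖ with hR
  have hRm : Measurable R := by fun_prop
  have hR0 : ∀ ξ, 0 ≤ R ξ := fun ξ => by positivity
  have hu2 : ∀ t ∈ S, ∀ ξ, 0 < R ξ → (‖u t ξ‖₊ : ℝ≥0∞) ^ 2 ≤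
      ENNReal.ofReal ((R ξ ^ 2)⁻¹) *
        ∫⁻ s in S, heatK (R ξ) (t - s) * (‖F s ξ‖₊ : ℝ≥0∞) ^ 2 := by
    intro t ht ξ hξ
    have := u_bound (f := fun s => F s ξ) (hF.comp (measurable_id.prodMk measurable_const)) hξ
      (hS t ht)
    rw [hu t ξ]
    have e : 4 * Real.pi ^ 2 * ‖ξ‖ ^ 2 = R ξ ^ 2 := by simp only [hR]; ring
    rw [e]
    exact this
  have hRinv : ∀ ξ, (R ξ) ^ (-1 : ℝ) = (R ξ)⁻¹ := fun ξ => Real.rpow_neg_one _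
  have h2F : Measurable (fun p : ℝ × EuclideanSpace ℝ (Fin 3) => (‖F p.1 p.2‖₊ : ℝ≥0∞) ^ 2) := by
    have : Measurable (fun p : ℝ × EuclideanSpace ℝ (Fin 3) => F p.1 p.2) := hF
    fun_prop
  set A := ∫⁻ s in S, ∫⁻ ξ : EuclideanSpace ℝ (Fin 3),
      ENNReal.ofReal ((R ξ) ^ (-1 : ℝ)) * (‖F s ξ‖₊ : ℝ≥0∞) ^ (2:ℕ) with hA
  have b1 : (⨆ t ∈ S, ∫⁻ ξ : EuclideanSpace ℝ (Fin 3),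
      ENNReal.ofReal (R ξ) * (‖u t ξ‖₊ : ℝ≥0∞) ^ (2:ℕ)) ≤ A := by
    refine iSup₂_le fun t ht => ?_
    calc _ ≤ ∫⁻ ξ : EuclideanSpace ℝ (Fin 3), ∫⁻ s in S,
          ENNReal.ofReal ((R ξ) ^ (-1 : ℝ)) * (‖F s ξ‖₊ : ℝ≥0∞) ^ (2:ℕ) := by
          refine lintegral_mono fun ξ => ?_
          rcases (hR0 ξ).eq_or_lt with h0 | h0
          · rw [← h0]; simp
          rw [lintegral_const_mul' _ _ ENNReal.ofReal_ne_top]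
          refine (mul_le_mul' le_rfl (hu2 t ht ξ h0)).trans ?_
          rw [← mul_assoc, ← ENNReal.ofReal_mul h0.le]
          refine mul_le_mul' (le_of_eq ?_) (lintegral_mono fun s => ?_)
          · rw [hRinv]; congr 1; field_simp
          · exact mul_le_of_le_one_left' (heatK_le_one _ _)
      _ = A := by
          rw [hA, lintegral_lintegral_swap]
          refine Measurable.aemeasurable ?_
          exact ((hRm.comp measurable_fst).pow_const _).ennreal_ofReal.mul
            (h2F.comp measurable_swap)
  have b2 : (∫⁻ t in S, ∫⁻ ξ : EuclideanSpace ℝ (Fin 3),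
      ENNReal.ofReal ((R ξ) ^ (3:ℕ)) * (‖u t ξ‖₊ : ℝ≥0∞) ^ (2:ℕ)) ≤ A := by
    have hSm : MeasurableSet S :=
      (measurableSet_lt measurable_const measurable_id).inter
        (measurableSet_lt ENNReal.measurable_ofReal measurable_const)
    let G : ℝ → ℝ → EuclideanSpace ℝ (Fin 3) → ℝ≥0∞ := fun t s ξ =>
      ENNReal.ofReal (R ξ) * (heatK (R ξ) (t - s) * (‖F s ξ‖₊ : ℝ≥0∞) ^ 2)
    have hG : Measurable (fun p : (ℝ × ℝ) × EuclideanSpace ℝ (Fin 3) => G p.1.1 p.1.2 p.2) := by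
      refine (hRm.comp measurable_snd).ennreal_ofReal.mul (Measurable.mul ?_ ?_)
      · exact heatK_meas.comp ((hRm.comp measurable_snd).prodMk
          ((measurable_fst.comp measurable_fst).sub (measurable_snd.comp measurable_fst)))
      · exact h2F.comp ((measurable_snd.comp measurable_fst).prodMk measurable_snd)
    calc _ ≤ ∫⁻ t in S, ∫⁻ ξ, ∫⁻ s in S, G t s ξ := by
          refine setLIntegral_mono' hSm fun t ht => lintegral_mono fun ξ => ?_
          rcases (hR0 ξ).eq_or_lt with h0 | h0
          · rw [← h0]; simp
          simp only [G]
          rw [lintegral_const_mul' _ _ ENNReal.ofReal_ne_top]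
          refine (mul_le_mul' le_rfl (hu2 t ht ξ h0)).trans ?_
          rw [← mul_assoc, ← ENNReal.ofReal_mul (by positivity)]
          refine mul_le_mul' (le_of_eq ?_) le_rfl
          congr 1; field_simp
      _ = ∫⁻ s in S, ∫⁻ ξ, ∫⁻ t in S, G t s ξ := swap3 _ _ G hG
      _ ≤ A := by
          refine lintegral_mono fun s => lintegral_mono fun ξ => ?_
          rcases (hR0 ξ).eq_or_lt with h0 | h0
          · simp only [G]; rw [← h0]; simp
          simp only [G]
          rw [lintegral_const_mul' _ _ ENNReal.ofReal_ne_top,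
            lintegral_mul_const' _ _ (by simp), ← mul_assoc]
          refine mul_le_mul' ?_ le_rfl
          have : ∫⁻ t in S, heatK (R ξ) (t - s) ≤ ENNReal.ofReal ((R ξ ^ 2)⁻¹) := by
            refine (setLIntegral_le_lintegral _ _).trans ?_
            rw [lintegral_sub_right_eq_self (fun x => heatK (R ξ) x) s, heatK_int h0]
          refine (mul_le_mul' le_rfl this).trans (le_of_eq ?_)
          rw [← ENNReal.ofReal_mul h0.le, hRinv]; congr 1; field_simp
  calc _ ≤ A + A := add_le_add b1 b2
    _ = _ := by rw [← two_mul]; norm_num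
end
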